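/- Fix l > 0 and z ∈ ℂ ∖ [0, ∞), and let R(z) and G(z) be the integral operators defined below. If w ∈ L²(ℝ³) is such that R(z)w belongs to the L²(ℝ³)-closure of the range {G(z)u : u ∈ L²([0, l])}, then w = 0. In other words, the closed subspace 𝒩 = closure(G(z)L²([0,l])) intersects the range R(z)L²(ℝ³) only in the zero vector. -/

import Mathlib

open InnerProductSpace MeasureTheory Complex

/-- The branch of the complex square root with positive imaginary part,
defined off the ray `[0, ∞)`. -/
noncomputable def sqrtB (z : ℂ) : ℂ := Complex.I * (-z) ^ ((1 : ℂ) / 2)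

noncomputable abbrev L2R3 :=
  MeasureTheory.Lp ℂ 2 (volume : Measure (EuclideanSpace ℝ (Fin 3)))

/-- `L²([0, l])`. -/
noncomputable abbrev L2I (l : ℝ) :=
  MeasureTheory.Lp ℂ 2 (volume.restrict (Set.Icc (0 : ℝ) l))

/-- The embedding `s ↦ (s, 0, 0)` of `[0, l]` into `ℝ³`. -/
noncomputable def seg (s : ℝ) : EuclideanSpace ℝ (Fin 3) := EuclideanSpace.single 0 s

open Filter Topology Set
open scoped ContDiff

local notation "E3" => EuclideanSpace ℝ (Fin 3)

lemma sqrtB_im_pos {z : ℂ} (hz : ¬(z.im = 0 ∧ 0 ≤ z.re)) : 0 < (sqrtB z).im := by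
  have hz0 : -z ≠ 0 := by
    rintro h
    apply hz
    simp [neg_eq_zero.mp h]
  have hpi : (-z).arg ≠ Real.pi := by
    intro h
    rw [Complex.arg_eq_pi_iff] at h
    simp only [Complex.neg_re, Complex.neg_im, neg_eq_zero] at h
    exact hz ⟨h.2, by linarith [h.1]⟩
  have h1 := (-z).neg_pi_lt_arg
  have h2 := lt_of_le_of_ne (-z).arg_le_pi hpi
  rw [sqrtB, Complex.I_mul_im, Complex.cpow_def_of_ne_zero hz0, Complex.exp_re]
  refine mul_pos (Real.exp_pos _) (Real.cos_pos_of_mem_Ioo ?_)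
  have : (Complex.log (-z) * (1 / 2)).im = (-z).arg / 2 := by
    simp [Complex.mul_im, Complex.log_im, Complex.log_re]
    ring
  rw [this]
  constructor <;> linarith

/-- The smooth regularisation `√(‖y‖² + ε²)` of the Euclidean norm. -/
noncomputable def regNorm (ε : ℝ) (y : E3) : ℝ := √(‖y‖ ^ 2 + ε ^ 2)

lemma regNorm_pos {ε : ℝ} (hε : 0 < ε) (y : E3) : 0 < regNorm ε y := by
  unfold regNorm; positivity

lemma regNorm_sq (ε : ℝ) (y : E3) : regNorm ε y ^ 2 = ‖y‖ ^ 2 + ε ^ 2 :=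
  Real.sq_sqrt (by positivity)

lemma norm_le_regNorm (ε : ℝ) (y : E3) : ‖y‖ ≤ regNorm ε y :=
  Real.le_sqrt_of_sq_le (by nlinarith [sq_nonneg ε])

lemma continuous_regNorm (ε : ℝ) : Continuous (regNorm ε) := by
  unfold regNorm; fun_prop

lemma regNorm_smul {ε : ℝ} (hε : 0 < ε) (y : E3) : regNorm ε (ε • y) = ε * regNorm 1 y := by
  unfold regNorm
  rw [norm_smul, Real.norm_of_nonneg hε.le,
    show (ε * ‖y‖) ^ 2 + ε ^ 2 = ε ^ 2 * (‖y‖ ^ 2 + 1 ^ 2) by ring,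
    Real.sqrt_mul (sq_nonneg ε), Real.sqrt_sq hε.le]

lemma one_le_regNorm_one (y : E3) : 1 ≤ regNorm 1 y :=
  Real.one_le_sqrt.mpr (by nlinarith [sq_nonneg ‖y‖])

/-- The `i`-th standard basis vector of `ℝ³`. -/
noncomputable abbrev stdVec (i : Fin 3) : E3 := EuclideanSpace.single i 1

lemma hasLineDerivAt_regNorm {ε : ℝ} (hε : 0 < ε) (y : E3) (i : Fin 3) :
    HasLineDerivAt ℝ (regNorm ε) (y i / regNorm ε y) y (stdVec i) := by
  have h1 : HasDerivAt (fun t : ℝ => y + t • stdVec i) (stdVec i) 0 := by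
    simpa using ((hasDerivAt_id (0 : ℝ)).smul_const (stdVec i)).const_add y
  have h2 := (h1.norm_sq.add_const (ε ^ 2)).sqrt (by positivity)
  unfold HasLineDerivAt
  refine HasDerivAt.congr_deriv h2 ?_
  simp only [zero_smul, add_zero, regNorm, EuclideanSpace.inner_single_right, conj_trivial, one_mul]
  exact mul_div_mul_left _ _ two_ne_zero

lemma hasLineDerivAt_comp_regNorm {ε : ℝ} (hε : 0 < ε) (y : E3) (i : Fin 3) {g : ℝ → ℂ} {g' : ℂ}
    (hg : HasDerivAt g g' (regNorm ε y)) :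
    HasLineDerivAt ℝ (fun x => g (regNorm ε x)) ((y i / regNorm ε y : ℝ) * g') y (stdVec i) := by
  have h := hasLineDerivAt_regNorm hε y i
  unfold HasLineDerivAt at h ⊢
  have hg' : HasDerivAt g g' (regNorm ε (y + (0 : ℝ) • stdVec i)) := by simpa using hg
  simpa [Function.comp_def] using hg'.scomp (0 : ℝ) h

/-- The radial profile of the outgoing fundamental solution (up to `4π`). -/
noncomputable def radProfile (k : ℂ) (r : ℝ) : ℂ := cexp (I * k * r) / r

/-- The derivative of the radial profile, divided by `r`. -/
noncomputable def radProfileOne (k : ℂ) (r : ℝ) : ℂ := cexp (I * k * r) * (I * k * r - 1) / r ^ 3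

/-- The result of applying `r⁻¹ d/dr` twice to the radial profile. -/
noncomputable def radProfileTwo (k : ℂ) (r : ℝ) : ℂ :=
  cexp (I * k * r) * (3 - 3 * I * k * r - k ^ 2 * r ^ 2) / r ^ 5

lemma hasDerivAt_radExp (k : ℂ) (r : ℝ) :
    HasDerivAt (fun r : ℝ => cexp (I * k * r)) (cexp (I * k * r) * (I * k)) r := by
  have h : HasDerivAt (fun r : ℝ => I * k * (r : ℂ)) (I * k) r := by
    simpa using (Complex.ofRealCLM.hasDerivAt (x := r)).const_mul (I * k)
  exact h.cexp

lemma hasDerivAt_radProfile (k : ℂ) {r : ℝ} (hr : r ≠ 0) :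
    HasDerivAt (radProfile k) (r * radProfileOne k r) r := by
  have hr' : (r : ℂ) ≠ 0 := by exact_mod_cast hr
  have h := (hasDerivAt_radExp k r).div (Complex.ofRealCLM.hasDerivAt (x := r)) hr'
  refine h.congr_deriv ?_
  simp only [radProfileOne, Complex.ofRealCLM_apply, Complex.ofReal_one]
  field_simp

lemma hasDerivAt_radProfileOne (k : ℂ) {r : ℝ} (hr : r ≠ 0) :
    HasDerivAt (radProfileOne k) (r * radProfileTwo k r) r := by
  have hr' : (r : ℂ) ≠ 0 := by exact_mod_cast hr
  have hid := Complex.ofRealCLM.hasDerivAt (x := r)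
  have h := ((hasDerivAt_radExp k r).mul ((hid.const_mul (I * k)).sub_const 1)).div (hid.pow 3)
    (pow_ne_zero 3 hr')
  refine h.congr_deriv ?_
  simp only [radProfileTwo, Complex.ofRealCLM_apply, Complex.ofReal_one, Pi.mul_apply, Pi.pow_apply]
  field_simp
  push_cast
  ring_nf
  simp only [I_sq]
  ring

lemma hasLineDerivAt_radProfile {ε : ℝ} (hε : 0 < ε) (k : ℂ) (y : E3) (i : Fin 3) :
    HasLineDerivAt ℝ (fun x => radProfile k (regNorm ε x))
      (y i * radProfileOne k (regNorm ε y)) y (stdVec i) := by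
  have hr := (regNorm_pos hε y).ne'
  have hr' : (regNorm ε y : ℂ) ≠ 0 := by exact_mod_cast hr
  have h := hasLineDerivAt_comp_regNorm hε y i (hasDerivAt_radProfile k hr)
  convert h using 1
  push_cast
  field_simp

lemma hasLineDerivAt_coord_mul_radProfileOne {ε : ℝ} (hε : 0 < ε) (k : ℂ) (y : E3) (i : Fin 3) :
    HasLineDerivAt ℝ (fun x => (x i : ℂ) * radProfileOne k (regNorm ε x))
      (radProfileOne k (regNorm ε y) + y i ^ 2 * radProfileTwo k (regNorm ε y)) y (stdVec i) := by
  have hr := (regNorm_pos hε y).ne'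
  have hr' : (regNorm ε y : ℂ) ≠ 0 := by exact_mod_cast hr
  have h := hasLineDerivAt_comp_regNorm hε y i (hasDerivAt_radProfileOne k hr)
  have hc : HasLineDerivAt ℝ (fun x : E3 => (x i : ℂ)) 1 y (stdVec i) := by
    unfold HasLineDerivAt
    have : HasDerivAt (fun t : ℝ => ((y i + t : ℝ) : ℂ)) 1 0 := by
      simpa using ((hasDerivAt_id (0 : ℝ)).const_add (y i)).ofReal_comp
    simpa using this
  unfold HasLineDerivAt at h hc ⊢
  refine (hc.mul h).congr_deriv ?_
  simp only [zero_smul, add_zero]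
  push_cast
  field_simp

/-- The operator `Δ + k²` on functions on `ℝ³`. -/
noncomputable def helmholtz (k : ℂ) (Φ : E3 → ℂ) (y : E3) : ℂ :=
  (∑ i, fderiv ℝ (fun x => fderiv ℝ Φ x (stdVec i)) y (stdVec i)) + k ^ 2 * Φ y

lemma contDiff_fderiv_stdVec {Φ : E3 → ℂ} (hΦ : ContDiff ℝ ∞ Φ) (i : Fin 3) :
    ContDiff ℝ ∞ (fun x => fderiv ℝ Φ x (stdVec i)) :=
  (hΦ.fderiv_right (m := ∞) (by simp)).clm_apply contDiff_const

lemma continuous_helmholtz (k : ℂ) {Φ : E3 → ℂ} (hΦ : ContDiff ℝ ∞ Φ) :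
    Continuous (helmholtz k Φ) :=
  (continuous_finsetSum _ fun i _ =>
    (contDiff_fderiv_stdVec (contDiff_fderiv_stdVec hΦ i) i).continuous).add
    (continuous_const.mul hΦ.continuous)

lemma hasCompactSupport_helmholtz (k : ℂ) {Φ : E3 → ℂ} (hc : HasCompactSupport Φ) :
    HasCompactSupport (helmholtz k Φ) := by
  refine HasCompactSupport.add (f := fun y =>
    ∑ i, fderiv ℝ (fun x => fderiv ℝ Φ x (stdVec i)) y (stdVec i)) ?_ hc.mul_left
  have h (i : Fin 3) := (hc.fderiv_apply ℝ (stdVec i)).fderiv_apply ℝ (stdVec i)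
  simp only [Fin.sum_univ_three]
  exact ((h 0).add (h 1)).add (h 2)

lemma helmholtz_comp_add_right (k : ℂ) (Φ : E3 → ℂ) (x y : E3) :
    helmholtz k (fun v => Φ (v + x)) y = helmholtz k Φ (y + x) := by
  simp only [helmholtz, fderiv_comp_add_right]
  congr 1
  refine Finset.sum_congr rfl fun i _ => ?_
  rw [fderiv_comp_add_right (f := fun v => fderiv ℝ Φ v (stdVec i))]

lemma continuous_radProfile_regNorm {ε : ℝ} (hε : 0 < ε) (k : ℂ) :
    Continuous fun y => radProfile k (regNorm ε y) := by
  have := continuous_regNorm ε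
  unfold radProfile
  refine Continuous.div (by fun_prop) (by fun_prop) fun y => ?_
  exact_mod_cast (regNorm_pos hε y).ne'

lemma continuous_radProfileOne_regNorm {ε : ℝ} (hε : 0 < ε) (k : ℂ) :
    Continuous fun y => radProfileOne k (regNorm ε y) := by
  have := continuous_regNorm ε
  unfold radProfileOne
  refine Continuous.div (by fun_prop) (by fun_prop) fun y => ?_
  exact_mod_cast (pow_pos (regNorm_pos hε y) 3).ne'

lemma continuous_radProfileTwo_regNorm {ε : ℝ} (hε : 0 < ε) (k : ℂ) :
    Continuous fun y => radProfileTwo k (regNorm ε y) := by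
  have := continuous_regNorm ε
  unfold radProfileTwo
  refine Continuous.div (by fun_prop) (by fun_prop) fun y => ?_
  exact_mod_cast (pow_pos (regNorm_pos hε y) 5).ne'

lemma integral_mul_fderiv_fderiv_stdVec {f f₁ f₂ Φ : E3 → ℂ} {i : Fin 3}
    (hf : Continuous f) (hf₁ : Continuous f₁) (hf₂ : Continuous f₂)
    (h₁ : ∀ y, HasLineDerivAt ℝ f (f₁ y) y (stdVec i))
    (h₂ : ∀ y, HasLineDerivAt ℝ f₁ (f₂ y) y (stdVec i))
    (hΦ : ContDiff ℝ ∞ Φ) (hc : HasCompactSupport Φ) :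
    ∫ y, f y * fderiv ℝ (fun x => fderiv ℝ Φ x (stdVec i)) y (stdVec i) = ∫ y, f₂ y * Φ y := by
  have hΦ₁ := contDiff_fderiv_stdVec hΦ i
  have hΦ₂ := contDiff_fderiv_stdVec hΦ₁ i
  have hc₁ := hc.fderiv_apply ℝ (stdVec i)
  have hc₂ := hc₁.fderiv_apply ℝ (stdVec i)
  have key {a : E3 → ℂ} {b : E3 → ℂ} (ha : Continuous a) (hb : Continuous b)
      (hbc : HasCompactSupport b) : Integrable fun y => a y * b y :=
    (ha.mul hb).integrable_of_hasCompactSupport hbc.mul_left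
  have line {b : E3 → ℂ} (hb : ContDiff ℝ ∞ b) (y : E3) :
      HasLineDerivAt ℝ b (fderiv ℝ b y (stdVec i)) y (stdVec i) :=
    (hb.differentiable (by simp) y).hasFDerivAt.hasLineDerivAt _
  have e₁ := integral_bilinear_hasLineDerivAt_right_eq_neg_left_of_integrable (μ := volume)
    (B := ContinuousLinearMap.mul ℝ ℂ) (key hf₁ hΦ₁.continuous hc₁) (key hf hΦ₂.continuous hc₂)
    (key hf hΦ₁.continuous hc₁) (fun y _ => h₁ y) (fun y _ => line hΦ₁ y)
  have e₂ := integral_bilinear_hasLineDerivAt_right_eq_neg_left_of_integrable (μ := volume)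
    (B := ContinuousLinearMap.mul ℝ ℂ) (key hf₂ hΦ.continuous hc) (key hf₁ hΦ₁.continuous hc₁)
    (key hf₁ hΦ.continuous hc) (fun y _ => h₂ y) (fun y _ => line hΦ y)
  simp only [ContinuousLinearMap.mul_apply'] at e₁ e₂
  rw [e₁, e₂, neg_neg]

lemma integral_radProfile_regNorm_mul_helmholtz {ε : ℝ} (hε : 0 < ε) (k : ℂ) {Φ : E3 → ℂ}
    (hΦ : ContDiff ℝ ∞ Φ) (hc : HasCompactSupport Φ) :
    ∫ y, radProfile k (regNorm ε y) * helmholtz k Φ y =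
      -∫ y, ε ^ 2 * radProfileTwo k (regNorm ε y) * Φ y := by
  have c₀ := continuous_radProfile_regNorm hε k
  have c₁ := continuous_radProfileOne_regNorm hε k
  have c₂ := continuous_radProfileTwo_regNorm hε k
  have key {a : E3 → ℂ} {b : E3 → ℂ} (ha : Continuous a) (hb : Continuous b)
      (hbc : HasCompactSupport b) : Integrable fun y => a y * b y :=
    (ha.mul hb).integrable_of_hasCompactSupport hbc.mul_left
  have hint (i : Fin 3) : Integrable fun y => radProfile k (regNorm ε y) *
      fderiv ℝ (fun x => fderiv ℝ Φ x (stdVec i)) y (stdVec i) :=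
    key c₀ (contDiff_fderiv_stdVec (contDiff_fderiv_stdVec hΦ i) i).continuous
      ((hc.fderiv_apply ℝ (stdVec i)).fderiv_apply ℝ (stdVec i))
  have hcoord (i : Fin 3) : Continuous fun y : E3 => (y i : ℂ) := by fun_prop
  have hcont (i : Fin 3) : Continuous fun y : E3 =>
      radProfileOne k (regNorm ε y) + (y i : ℂ) ^ 2 * radProfileTwo k (regNorm ε y) :=
    c₁.add (((hcoord i).pow 2).mul c₂)
  have hparts (i : Fin 3) := integral_mul_fderiv_fderiv_stdVec c₀ ((hcoord i).mul c₁) (hcont i)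
    (fun y => hasLineDerivAt_radProfile hε k y i)
    (fun y => hasLineDerivAt_coord_mul_radProfileOne hε k y i) hΦ hc
  have hk : Integrable fun y => radProfile k (regNorm ε y) * (k ^ 2 * Φ y) :=
    key c₀ (continuous_const.mul hΦ.continuous) hc.mul_left
  simp only [helmholtz, mul_add, Finset.mul_sum]
  rw [integral_add (integrable_finsetSum _ fun i _ => hint i) hk,
    integral_finsetSum _ fun i _ => hint i, Finset.sum_congr rfl fun i _ => hparts i,
    ← integral_finsetSum _ fun i _ => key (hcont i) hΦ.continuous hc,
    ← integral_add (integrable_finsetSum _ fun i _ => key (hcont i) hΦ.continuous hc) hk,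
    ← integral_neg]
  congr 1
  ext y
  have hr : (regNorm ε y : ℂ) ≠ 0 := by exact_mod_cast (regNorm_pos hε y).ne'
  have hsq : (regNorm ε y : ℂ) ^ 2 =
      (y 0 : ℂ) ^ 2 + (y 1 : ℂ) ^ 2 + (y 2 : ℂ) ^ 2 + (ε : ℂ) ^ 2 := by
    have := regNorm_sq ε y
    rw [EuclideanSpace.real_norm_sq_eq, Fin.sum_univ_three] at this
    exact_mod_cast this
  have halg : 3 * radProfileOne k (regNorm ε y) +
      (regNorm ε y : ℂ) ^ 2 * radProfileTwo k (regNorm ε y) +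
      k ^ 2 * radProfile k (regNorm ε y) = 0 := by
    simp only [radProfile, radProfileOne, radProfileTwo]
    field_simp
    ring
  rw [Fin.sum_univ_three]
  rw [hsq] at halg
  linear_combination Φ y * halg

lemma norm_cexp_I_mul (k : ℂ) (r : ℝ) : ‖cexp (I * k * r)‖ = Real.exp (-(k.im * r)) := by
  rw [Complex.norm_exp]
  simp

lemma integrable_exp_neg_norm_div_norm {κ : ℝ} (hκ : 0 < κ) :
    Integrable fun y : E3 => Real.exp (-(κ * ‖y‖)) / ‖y‖ := by
  rw [integrable_fun_norm_addHaar volume (f := fun r : ℝ => Real.exp (-(κ * r)) / r)]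
  have h := integrableOn_rpow_mul_exp_neg_mul_rpow (p := 1) (s := 1) (by norm_num) one_pos hκ
  refine h.congr_fun (fun r hr => ?_) measurableSet_Ioi
  have hr' : r ≠ 0 := (mem_Ioi.mp hr).ne'
  simp only [finrank_euclideanSpace, Fintype.card_fin, smul_eq_mul, Real.rpow_one, neg_mul]
  norm_num
  field_simp

lemma measurable_radProfile (k : ℂ) : Measurable (radProfile k) := by
  unfold radProfile
  fun_prop

lemma norm_radProfile (k : ℂ) {r : ℝ} (hr : 0 ≤ r) :
    ‖radProfile k r‖ = Real.exp (-(k.im * r)) / r := by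
  rw [radProfile, norm_div, norm_cexp_I_mul, Complex.norm_of_nonneg hr]

lemma integrable_radProfile_norm {k : ℂ} (hk : 0 < k.im) :
    Integrable fun y : E3 => radProfile k ‖y‖ :=
  (integrable_exp_neg_norm_div_norm hk).mono'
    ((measurable_radProfile k).comp measurable_norm).aestronglyMeasurable
    (.of_forall fun y => (norm_radProfile k (norm_nonneg y)).le)

lemma norm_radProfile_regNorm_le {k : ℂ} (hk : 0 < k.im) (ε : ℝ) {y : E3} (hy : y ≠ 0) :
    ‖radProfile k (regNorm ε y)‖ ≤ Real.exp (-(k.im * ‖y‖)) / ‖y‖ := by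
  have hy' : 0 < ‖y‖ := norm_pos_iff.mpr hy
  have h := norm_le_regNorm ε y
  rw [norm_radProfile k (hy'.le.trans h)]
  gcongr

lemma tendsto_regNorm_zero (y : E3) : Tendsto (fun ε => regNorm ε y) (𝓝[>] 0) (𝓝 ‖y‖) := by
  have : Continuous fun ε => regNorm ε y := by unfold regNorm; fun_prop
  have h := this.tendsto 0
  simp only [regNorm, ne_eq, OfNat.ofNat_ne_zero, not_false_eq_true, zero_pow, add_zero,
    Real.sqrt_sq (norm_nonneg y)] at h
  exact h.mono_left nhdsWithin_le_nhds

lemma tendsto_integral_radProfile_regNorm {k : ℂ} (hk : 0 < k.im) {ψ : E3 → ℂ}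
    (hψ : Continuous ψ) (hc : HasCompactSupport ψ) :
    Tendsto (fun ε => ∫ y, radProfile k (regNorm ε y) * ψ y) (𝓝[>] 0)
      (𝓝 (∫ y, radProfile k ‖y‖ * ψ y)) := by
  obtain ⟨C, hC⟩ := hψ.bounded_above_of_compact_support hc
  have hne : ∀ᵐ y : E3, y ≠ 0 := by simp [ae_iff]
  refine tendsto_integral_filter_of_dominated_convergence
    (fun y => Real.exp (-(k.im * ‖y‖)) / ‖y‖ * C) ?_ ?_
    ((integrable_exp_neg_norm_div_norm hk).mul_const C) ?_
  · filter_upwards [self_mem_nhdsWithin] with ε hε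
    exact ((continuous_radProfile_regNorm hε k).mul hψ).aestronglyMeasurable
  · refine .of_forall fun ε => ?_
    filter_upwards [hne] with y hy
    rw [norm_mul]
    gcongr
    exacts [norm_radProfile_regNorm_le hk ε hy, hC y]
  · filter_upwards [hne] with y hy
    refine Tendsto.mul_const _ ?_
    exact ((hasDerivAt_radProfile k (norm_ne_zero_iff.mpr hy)).continuousAt.tendsto).comp
      (tendsto_regNorm_zero y)

lemma integrable_regNorm_one_inv_pow : Integrable fun y : E3 => (regNorm 1 y ^ 5)⁻¹ := by
  have h : Integrable fun x : E3 => ((1 : ℝ) + ‖x‖ ^ 2) ^ (-(4 : ℝ) / 2) :=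
    integrable_rpow_neg_one_add_norm_sq (by simp; norm_num)
  have hne (y : E3) : regNorm 1 y ^ 5 ≠ 0 := (pow_pos (regNorm_pos one_pos y) 5).ne'
  refine h.mono' (((continuous_regNorm 1).pow 5).inv₀ hne).aestronglyMeasurable
    (.of_forall fun y => ?_)
  have h1 := one_le_regNorm_one y
  have h2 : ((1 : ℝ) + ‖y‖ ^ 2) ^ (-(4 : ℝ) / 2) = (regNorm 1 y ^ 4)⁻¹ := by
    rw [show regNorm 1 y ^ 4 = (regNorm 1 y ^ 2) ^ 2 by ring, regNorm_sq, add_comm,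
      show (-(4 : ℝ) / 2) = -((2 : ℕ) : ℝ) by norm_num, Real.rpow_neg (by positivity),
      Real.rpow_natCast, one_pow]
  rw [h2, Real.norm_of_nonneg (by positivity)]
  gcongr
  norm_num

lemma exists_norm_exp_mul_quadratic_le {k : ℂ} (hk : 0 < k.im) :
    ∃ C, ∀ t : ℝ, 0 ≤ t → ‖cexp (I * k * t) * (3 - 3 * I * k * t - k ^ 2 * t ^ 2)‖ ≤ C := by
  refine ⟨3 + 3 * ‖k‖ / k.im + 2 * ‖k‖ ^ 2 / k.im ^ 2, fun t ht => ?_⟩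
  have hkt : 0 ≤ k.im * t := by positivity
  have hq := Real.quadratic_le_exp_of_nonneg hkt
  rw [norm_mul, norm_cexp_I_mul, Real.exp_neg, inv_mul_le_iff₀ (Real.exp_pos _)]
  have hpoly : ‖3 - 3 * I * k * t - k ^ 2 * t ^ 2‖ ≤ 3 + 3 * ‖k‖ * t + ‖k‖ ^ 2 * t ^ 2 := by
    refine (norm_sub_le _ _).trans (add_le_add ((norm_sub_le _ _).trans ?_) ?_)
    · simp [abs_of_nonneg ht]
    · simp
  have e1 : 3 * ‖k‖ * t = 3 * ‖k‖ / k.im * (k.im * t) := by field_simp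
  have e2 : ‖k‖ ^ 2 * t ^ 2 = 2 * ‖k‖ ^ 2 / k.im ^ 2 * ((k.im * t) ^ 2 / 2) := by field_simp
  refine hpoly.trans ?_
  rw [e1, e2, mul_add, mul_add]
  have hsq : 0 ≤ (k.im * t) ^ 2 := sq_nonneg _
  have a1 : 3 ≤ Real.exp (k.im * t) * 3 := by linarith
  have a2 : 3 * ‖k‖ / k.im * (k.im * t) ≤ Real.exp (k.im * t) * (3 * ‖k‖ / k.im) := by
    rw [mul_comm (Real.exp _)]
    gcongr
    linarith
  have a3 : 2 * ‖k‖ ^ 2 / k.im ^ 2 * ((k.im * t) ^ 2 / 2) ≤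
      Real.exp (k.im * t) * (2 * ‖k‖ ^ 2 / k.im ^ 2) := by
    rw [mul_comm (Real.exp _)]
    gcongr
    linarith
  linarith

lemma integral_radProfileTwo_rescale {ε : ℝ} (hε : 0 < ε) (k : ℂ) (Φ : E3 → ℂ) :
    ∫ y, ε ^ 2 * radProfileTwo k (regNorm ε y) * Φ y =
      ∫ x, cexp (I * k * (ε * regNorm 1 x : ℝ)) * (3 - 3 * I * k * (ε * regNorm 1 x : ℝ) -
        k ^ 2 * (ε * regNorm 1 x : ℝ) ^ 2) * ((regNorm 1 x ^ 5)⁻¹ : ℝ) * Φ (ε • x) := by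
  have hε' : (ε : ℂ) ≠ 0 := by exact_mod_cast hε.ne'
  have h := Measure.integral_comp_smul_of_nonneg (volume : Measure E3)
    (fun y => (ε : ℂ) ^ 2 * radProfileTwo k (regNorm ε y) * Φ y) ε (hR := hε.le)
  rw [finrank_euclideanSpace, Fintype.card_fin, Complex.real_smul, Complex.ofReal_inv,
    Complex.ofReal_pow, eq_inv_mul_iff_mul_eq₀ (pow_ne_zero 3 hε'), ← integral_const_mul] at h
  rw [← h]
  congr 1
  ext x
  have hx : (regNorm 1 x : ℂ) ≠ 0 := by exact_mod_cast (regNorm_pos one_pos x).ne'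
  rw [regNorm_smul hε, radProfileTwo]
  push_cast
  field_simp

/-- The constant `∫ 3 (1 + ‖x‖²)^(-5/2) dx` (equal to `4π`). -/
noncomputable def massConst : ℝ := ∫ x : E3, 3 * (regNorm 1 x ^ 5)⁻¹

lemma massConst_pos : 0 < massConst := by
  have hne (y : E3) : regNorm 1 y ^ 5 ≠ 0 := (pow_pos (regNorm_pos one_pos y) 5).ne'
  have hpos (y : E3) : 0 < 3 * (regNorm 1 y ^ 5)⁻¹ := by
    have := regNorm_pos one_pos y
    positivity
  exact integral_pos_of_integrable_nonneg_nonzero (x := 0)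
    (continuous_const.mul (((continuous_regNorm 1).pow 5).inv₀ hne))
    (integrable_regNorm_one_inv_pow.const_mul 3) (fun y => (hpos y).le) (hpos 0).ne'

lemma tendsto_integral_radProfileTwo {k : ℂ} (hk : 0 < k.im) {Φ : E3 → ℂ}
    (hΦ : Continuous Φ) (hc : HasCompactSupport Φ) :
    Tendsto (fun ε : ℝ => ∫ y, ε ^ 2 * radProfileTwo k (regNorm ε y) * Φ y) (𝓝[>] 0)
      (𝓝 (massConst * Φ 0)) := by
  obtain ⟨D, hD⟩ := hΦ.bounded_above_of_compact_support hc
  obtain ⟨C, hC⟩ := exists_norm_exp_mul_quadratic_le hk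
  have hrn := continuous_regNorm 1
  have hne (y : E3) : regNorm 1 y ^ 5 ≠ 0 := (pow_pos (regNorm_pos one_pos y) 5).ne'
  have hinv : Continuous fun y : E3 => (regNorm 1 y ^ 5)⁻¹ := (hrn.pow 5).inv₀ hne
  have hlim : (massConst : ℂ) * Φ 0 = ∫ x, (3 * ((regNorm 1 x ^ 5)⁻¹ : ℝ) : ℂ) * Φ 0 := by
    rw [integral_mul_const, massConst, ← integral_complex_ofReal]
    simp
  rw [hlim]
  refine Tendsto.congr' (f₁ := fun ε : ℝ => ∫ x, cexp (I * k * (ε * regNorm 1 x : ℝ)) *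
    (3 - 3 * I * k * (ε * regNorm 1 x : ℝ) - k ^ 2 * (ε * regNorm 1 x : ℝ) ^ 2) *
      ((regNorm 1 x ^ 5)⁻¹ : ℝ) * Φ (ε • x)) ?_ ?_
  · filter_upwards [self_mem_nhdsWithin] with ε hε
    exact (integral_radProfileTwo_rescale hε k Φ).symm
  refine tendsto_integral_filter_of_dominated_convergence
    (fun y => C * (regNorm 1 y ^ 5)⁻¹ * D) (.of_forall fun ε => ?_) ?_
    ((integrable_regNorm_one_inv_pow.const_mul C).mul_const D) (.of_forall fun x => ?_)
  · exact Continuous.aestronglyMeasurable (by fun_prop)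
  · filter_upwards [self_mem_nhdsWithin] with ε hε
    refine .of_forall fun x => ?_
    have hx := regNorm_pos one_pos x
    have hb := hC (ε * regNorm 1 x) (mul_pos hε hx).le
    rw [norm_mul, norm_mul, Complex.norm_of_nonneg (by positivity)]
    have hC0 := (norm_nonneg _).trans hb
    gcongr
    exact hD _
  · have hcont : Continuous fun ε : ℝ => cexp (I * k * (ε * regNorm 1 x : ℝ)) *
        (3 - 3 * I * k * (ε * regNorm 1 x : ℝ) - k ^ 2 * (ε * regNorm 1 x : ℝ) ^ 2) *
          ((regNorm 1 x ^ 5)⁻¹ : ℝ) * Φ (ε • x) := by fun_prop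
    refine Tendsto.mono_left ?_ nhdsWithin_le_nhds
    simpa using hcont.tendsto 0

/-- `radProfile k ‖·‖` is, up to a nonzero constant, a fundamental solution of `Δ + k²`. -/
lemma integral_radProfile_mul_helmholtz {k : ℂ} (hk : 0 < k.im) {Φ : E3 → ℂ}
    (hΦ : ContDiff ℝ ∞ Φ) (hc : HasCompactSupport Φ) (x : E3) :
    ∫ y, radProfile k ‖y - x‖ * helmholtz k Φ y = -(massConst * Φ x) := by
  have hΨ : ContDiff ℝ ∞ (fun v => Φ (v + x)) := by fun_prop
  have hcΨ : HasCompactSupport (fun v => Φ (v + x)) :=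
    hc.comp_homeomorph (Homeomorph.addRight x)
  have h1 := tendsto_integral_radProfile_regNorm hk (continuous_helmholtz k hΨ)
    (hasCompactSupport_helmholtz k hcΨ)
  have h2 := (tendsto_integral_radProfileTwo hk hΨ.continuous hcΨ).neg
  have h3 := tendsto_nhds_unique (h1.congr' ?_) h2
  · rw [← integral_add_right_eq_self _ x]
    simpa [helmholtz_comp_add_right] using h3
  · filter_upwards [self_mem_nhdsWithin] with ε hε
    exact integral_radProfile_regNorm_mul_helmholtz hε k hΨ hcΨ

lemma integrable_radProfile_sub_mul {X : Type*} [MeasurableSpace X] {μ : Measure X} [SFinite μ]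
    {k : ℂ} (hk : 0 < k.im) {p : X → E3} (hp : Measurable p) {f : X → ℂ} (hf : Integrable f μ) :
    Integrable (fun q : E3 × X => radProfile k ‖q.1 - p q.2‖ * f q.2) (volume.prod μ) := by
  have hm : Measurable fun q : E3 × X => radProfile k ‖q.1 - p q.2‖ :=
    (measurable_radProfile k).comp (measurable_fst.sub (hp.comp measurable_snd)).norm
  refine (integrable_prod_iff' (hm.aestronglyMeasurable.mul
    hf.aestronglyMeasurable.comp_snd)).mpr ?_
  have hK := integrable_radProfile_norm hk
  refine ⟨.of_forall fun s => (hK.comp_sub_right (p s)).mul_const (f s), ?_⟩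
  have (s : X) : ∫ y, ‖radProfile k ‖y - p s‖ * f s‖ = (∫ y : E3, ‖radProfile k ‖y‖‖) * ‖f s‖ := by
    simp only [norm_mul]
    rw [integral_mul_const, integral_sub_right_eq_self (fun y : E3 => ‖radProfile k ‖y‖‖)]
  change Integrable (fun s => ∫ y, ‖radProfile k ‖y - p s‖ * f s‖) μ
  simp only [this]
  exact hf.norm.const_mul _

lemma integral_radProfile_sub_mul_helmholtz {X : Type*} [MeasurableSpace X] {μ : Measure X}
    [SFinite μ] {k : ℂ} (hk : 0 < k.im) {Φ : E3 → ℂ} (hΦ : ContDiff ℝ ∞ Φ)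
    (hc : HasCompactSupport Φ) (p : X → E3) (u : X → ℂ)
    (hint : Integrable (fun q : E3 × X => radProfile k ‖q.1 - p q.2‖ * u q.2 *
      helmholtz k Φ q.1) (volume.prod μ)) :
    ∫ y, (∫ s, radProfile k ‖y - p s‖ * u s ∂μ) * helmholtz k Φ y =
      -(massConst * ∫ s, u s * Φ (p s) ∂μ) := by
  simp only [← integral_mul_const]
  rw [integral_integral_swap (f := fun y s => radProfile k ‖y - p s‖ * u s * helmholtz k Φ y) hint,
    ← integral_const_mul, ← integral_neg]
  congr 1
  ext s
  have h := integral_radProfile_mul_helmholtz hk hΦ hc (p s)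
  calc ∫ y, radProfile k ‖y - p s‖ * u s * helmholtz k Φ y
      = u s * ∫ y, radProfile k ‖y - p s‖ * helmholtz k Φ y := by
        rw [← integral_const_mul]
        congr 1
        ext y
        ring
    _ = _ := by rw [h]; ring

lemma integrable_radProfile_mul_of_integrable {X : Type*} [MeasurableSpace X] {μ : Measure X}
    [SFinite μ] {k : ℂ} (hk : 0 < k.im) {p : X → E3} (hp : Measurable p) {u : X → ℂ}
    (hu : Integrable u μ) {ψ : E3 → ℂ} (hψ : Continuous ψ) (hc : HasCompactSupport ψ) :
    Integrable (fun q : E3 × X => radProfile k ‖q.1 - p q.2‖ * u q.2 * ψ q.1)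
      (volume.prod μ) := by
  obtain ⟨C, hC⟩ := hψ.bounded_above_of_compact_support hc
  exact (integrable_radProfile_sub_mul hk hp hu).mul_bdd (c := C)
    hψ.aestronglyMeasurable.comp_fst (.of_forall fun q => hC q.1)

lemma integrable_radProfile_mul_of_memLp_two {k : ℂ} (hk : 0 < k.im) {u ψ : E3 → ℂ}
    (hu : MemLp u 2) (hψ : MemLp ψ 2) :
    Integrable (fun q : E3 × E3 => radProfile k ‖q.1 - q.2‖ * u q.2 * ψ q.1)
      (volume.prod volume) := by
  have sq {f : E3 → ℂ} (hf : MemLp f 2) : Integrable fun y => ((‖f y‖ ^ 2 : ℝ) : ℂ) :=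
    ((memLp_two_iff_integrable_sq_norm hf.1).mp hf).ofReal
  have h1 := (integrable_radProfile_sub_mul hk measurable_id (sq hu)).norm
  have h2 := (integrable_radProfile_sub_mul hk measurable_id (sq hψ)).norm.swap
  have hm : Measurable fun q : E3 × E3 => radProfile k ‖q.1 - q.2‖ :=
    (measurable_radProfile k).comp (measurable_fst.sub measurable_snd).norm
  refine (h1.add h2).mono'
    ((hm.aestronglyMeasurable.mul hu.1.comp_snd).mul hψ.1.comp_fst) (.of_forall fun q => ?_)
  simp only [Pi.add_apply, Function.comp_apply, Prod.swap, id, norm_mul, Complex.norm_real,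
    Real.norm_eq_abs, abs_pow, abs_norm]
  rw [norm_sub_rev q.2 q.1, ← mul_add, mul_assoc]
  gcongr
  nlinarith [sq_nonneg (‖u q.2‖ - ‖ψ q.1‖), norm_nonneg (u q.2), norm_nonneg (ψ q.1)]

lemma measurable_seg : Measurable seg := by
  have : seg = fun s => s • stdVec 0 := by
    ext s i
    simp [seg]
  rw [this]
  fun_prop

lemma exists_clm_eq_integral_mul {ψ : E3 → ℂ} (hψ : MemLp ψ 2) :
    ∃ T : L2R3 →L[ℂ] ℂ, ∀ f : L2R3, T f = ∫ y, f y * ψ y := by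
  have hs : MemLp (fun y => starRingEnd ℂ (ψ y)) 2 volume := hψ.star
  refine ⟨innerSL ℂ hs.toLp, fun f => ?_⟩
  rw [innerSL_apply_apply, L2.inner_def]
  refine integral_congr_ae ?_
  filter_upwards [hs.coeFn_toLp] with y hy
  rw [hy]
  simp [mul_comm]

lemma volume_setOf_coord_eq_zero : volume {y : E3 | y 1 = 0} = 0 := by
  let S : Submodule ℝ E3 := LinearMap.ker (EuclideanSpace.proj (1 : Fin 3) : E3 →L[ℝ] ℝ).toLinearMap
  have hS : S ≠ ⊤ := by
    intro h
    have : stdVec 1 ∈ S := h ▸ Submodule.mem_top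
    simp [S] at this
  exact Measure.addHaar_submodule volume S hS

theorem range_G_meets_range_R_trivially
    (l : ℝ) (hl : 0 < l) (z : ℂ) (hz : ¬(z.im = 0 ∧ 0 ≤ z.re))
    (R : L2R3 →L[ℂ] L2R3)
    (hR : ∀ f : L2R3,
      (R f : EuclideanSpace ℝ (Fin 3) → ℂ) =ᵐ[volume] fun y =>
        (∫ y' : EuclideanSpace ℝ (Fin 3),
            Complex.exp (Complex.I * sqrtB z * (‖y - y'‖ : ℂ)) / (‖y - y'‖ : ℂ) * f y')
          / (4 * (Real.pi : ℂ)))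
    (G : L2I l →L[ℂ] L2R3)
    (hG : ∀ u : L2I l,
      (G u : EuclideanSpace ℝ (Fin 3) → ℂ) =ᵐ[volume] fun y =>
        ∫ s in Set.Icc (0 : ℝ) l,
          Complex.exp (Complex.I * sqrtB z * (‖y - seg s‖ : ℂ))
            / (4 * (Real.pi : ℂ) * (‖y - seg s‖ : ℂ)) * u s) :
    ∀ w : L2R3, R w ∈ closure (Set.range G) → w = 0 := by
  have hk := sqrtB_im_pos hz
  set k := sqrtB z
  intro w hw
  have hπ : (4 * (Real.pi : ℂ)) ≠ 0 := by simp [Real.pi_ne_zero]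
  have htest (g : E3 → ℝ) (hg : ContDiff ℝ ∞ g) (hgc : HasCompactSupport g)
      (hgU : tsupport g ⊆ {y | y 1 ≠ 0}) : ∫ y, g y • w y = 0 := by
    set Φ : E3 → ℂ := fun y => (g y : ℂ)
    have hΦ : ContDiff ℝ ∞ Φ := Complex.ofRealCLM.contDiff.comp hg
    have hc : HasCompactSupport Φ := hgc.comp_left (g := fun r : ℝ => (r : ℂ)) (by simp)
    have hψ := continuous_helmholtz k hΦ
    have hψc := hasCompactSupport_helmholtz k hc
    have hψ2 : MemLp (helmholtz k Φ) 2 := hψ.memLp_of_hasCompactSupport hψc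
    obtain ⟨T, hT⟩ := exists_clm_eq_integral_mul hψ2
    have hTG (u : L2I l) : T (G u) = 0 := by
      have hu : Integrable u (volume.restrict (Icc 0 l)) :=
        (Lp.memLp u).integrable (by norm_num)
      have h := integral_radProfile_sub_mul_helmholtz hk hΦ hc seg u
        (integrable_radProfile_mul_of_integrable hk measurable_seg hu hψ hψc)
      have hseg (s : ℝ) : Φ (seg s) = 0 := by
        have : seg s ∉ tsupport g := fun hs => hgU hs (by simp [seg])
        simp [Φ, image_eq_zero_of_notMem_tsupport this]
      simp only [hseg, mul_zero, integral_zero, neg_zero] at h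
      have h' : T (G u) = (4 * (Real.pi : ℂ))⁻¹ *
          ∫ y, (∫ s in Icc 0 l, radProfile k ‖y - seg s‖ * u s) * helmholtz k Φ y := by
        rw [hT, ← integral_const_mul]
        refine integral_congr_ae ?_
        filter_upwards [hG u] with y hy
        rw [hy, ← mul_assoc, ← integral_const_mul]
        congr 2
        ext s
        rw [radProfile, div_mul_eq_div_div_swap]
        ring
      rw [h', h, mul_zero]
    have hTR : T (R w) = 0 := by
      have hcl : IsClosed {f | T f = 0} := isClosed_eq T.continuous continuous_const
      exact closure_minimal (by rintro _ ⟨u, rfl⟩; exact hTG u) hcl hw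
    have h := integral_radProfile_sub_mul_helmholtz hk hΦ hc id w
      (integrable_radProfile_mul_of_memLp_two hk (Lp.memLp w) hψ2)
    have h' : T (R w) = (4 * (Real.pi : ℂ))⁻¹ *
        ∫ y, (∫ s, radProfile k ‖y - id s‖ * w s) * helmholtz k Φ y := by
      rw [hT, ← integral_const_mul]
      refine integral_congr_ae ?_
      filter_upwards [hR w] with y hy
      rw [hy, div_eq_inv_mul, mul_assoc]
      rfl
    rw [h', h] at hTR
    have hm : (massConst : ℂ) ≠ 0 := by exact_mod_cast massConst_pos.ne'
    simpa [hπ, hm, Φ, mul_comm, Real.pi_ne_zero] using hTR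
  have hU : IsOpen {y : E3 | y 1 ≠ 0} := isOpen_ne_fun (by fun_prop) continuous_const
  have hloc : LocallyIntegrable (w : E3 → ℂ) volume :=
    (Lp.memLp w).locallyIntegrable (by norm_num)
  have hae := hU.ae_eq_zero_of_integral_contDiff_smul_eq_zero (hloc.locallyIntegrableOn _) htest
  rw [Lp.eq_zero_iff_ae_eq_zero]
  have hnull : ∀ᵐ y : E3, y 1 ≠ 0 := by
    simpa [ae_iff] using volume_setOf_coord_eq_zero
  filter_upwards [hae, hnull] with y h1 h2 using h1 h2
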